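/- λ-Lemma (Mañé–Sad–Sullivan): Any holomorphic motion h : Δ_r × E → Ĉ of a set E ⊂ Ĉ parametrized by the disk Δ_r extends to a holomorphic motion of the closure of E parametrized by the same disk Δ_r. -/

import Mathlib

open Metric Complex

/-- A holomorphic motion of a set `E ⊆ ℂ` parametrized by the disk of radius `r`. -/
def IsHolomorphicMotion (r : ℝ) (E : Set ℂ) (h : ℂ → ℂ → ℂ) : Prop :=
  (∀ z ∈ E, h 0 z = z) ∧
  (∀ c ∈ ball (0:ℂ) r, Set.InjOn (h c) E) ∧
  (∀ z ∈ E, DifferentiableOn ℂ (fun c => h c z) (ball (0:ℂ) r))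

theorem exists_differentiableOn_exp_eq {r : ℝ} {f : ℂ → ℂ} {w : ℂ}
    (hf : DifferentiableOn ℂ f (ball 0 r)) (hf0 : ∀ z ∈ ball 0 r, f z ≠ 0) (hw : w ∈ ball 0 r) :
    ∃ g : ℂ → ℂ, DifferentiableOn ℂ g (ball 0 r) ∧ g w = log (f w) ∧
      ∀ z ∈ ball 0 r, exp (g z) = f z := by
  have hd : DifferentiableOn ℂ (fun z => deriv f z / f z) (ball 0 r) :=
    (hf.deriv isOpen_ball).div hf hf0
  obtain ⟨G, hG⟩ := hd.isExactOn_ball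
  set g : ℂ → ℂ := fun z => G z - G w + log (f w) with hg_def
  have hg : ∀ z ∈ ball 0 r, HasDerivAt g (deriv f z / f z) z := fun z hz =>
    ((hG z hz).sub_const (G w)).add_const (log (f w))
  have hfd : ∀ z ∈ ball 0 r, HasDerivAt f (deriv f z) z := fun z hz =>
    (hf.differentiableAt (isOpen_ball.mem_nhds hz)).hasDerivAt
  have hgw : g w = log (f w) := by simp [hg_def]
  refine ⟨g, fun z hz => (hg z hz).differentiableAt.differentiableWithinAt, hgw, fun z hz => ?_⟩
  have hq : ∀ x ∈ ball 0 r, HasDerivAt (fun x => f x * exp (-g x)) 0 x := fun x hx => by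
    refine ((hfd x hx).mul ((hg x hx).neg.cexp)).congr_deriv ?_
    have := hf0 x hx
    simp only [Pi.neg_apply]
    field_simp
    ring
  have hc : f z * exp (-g z) = f w * exp (-g w) :=
    isOpen_ball.is_const_of_deriv_eq_zero (convex_ball _ _).isPreconnected
      (fun x hx => (hq x hx).differentiableAt.differentiableWithinAt)
      (fun x hx => (hq x hx).deriv) hz hw
  rw [hgw, exp_neg, exp_neg, exp_log (hf0 w hw), mul_inv_cancel₀ (hf0 w hw)] at hc
  exact (eq_of_mul_inv_eq_one hc).symm

theorem ball_subset_image_of_norm_deriv_le {f : ℂ → ℂ} {b : ℂ} {t : ℝ} (ht : 0 < t)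
    (hf : DifferentiableOn ℂ f (ball b t)) (hb : deriv f b ≠ 0)
    (hle : ∀ z ∈ ball b t, ‖deriv f z‖ ≤ 2 * ‖deriv f b‖) :
    ball (f b) (‖deriv f b‖ * t / 24) ⊆ f '' ball b t := by
  set m := ‖deriv f b‖ with hm_def
  have hm : 0 < m := norm_pos_iff.2 hb
  have hsub : closedBall b (t / 6) ⊆ ball b t := closedBall_subset_ball (by linarith)
  have hfd : ∀ z ∈ ball b t, HasDerivAt f (deriv f z) z := fun z hz =>
    (hf.differentiableAt (isOpen_ball.mem_nhds hz)).hasDerivAt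
  have hdev : ∀ z ∈ closedBall b (t / 6), ‖deriv f z - deriv f b‖ ≤ m / 2 := fun z hz => by
    have h := dist_le_div_mul_dist_of_mapsTo_ball (R₂ := 3 * m) (hf.deriv isOpen_ball)
      (fun x hx => by
        rw [mem_closedBall, dist_eq_norm]
        have := hle x hx
        have := norm_sub_le (deriv f x) (deriv f b)
        linarith) (hsub hz)
    rw [dist_eq_norm] at h
    refine h.trans ?_
    calc 3 * m / t * dist z b ≤ 3 * m / t * (t / 6) := by
          gcongr
          exact hz
      _ = m / 2 := by field_simp; norm_num
  have hlow : ∀ z ∈ closedBall b (t / 6), m / 2 * ‖z - b‖ ≤ ‖f z - f b‖ := fun z hz => by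
    have h := (convex_closedBall b (t / 6)).norm_image_sub_le_of_norm_hasDerivWithin_le
      (f := fun x => f x - deriv f b * x) (f' := fun x => deriv f x - deriv f b) (C := m / 2)
      (fun x hx => (((hfd x (hsub hx)).sub
        ((hasDerivAt_id x).const_mul (deriv f b))).congr_deriv (by simp)).hasDerivWithinAt)
      hdev (mem_closedBall_self (by positivity)) hz
    have e : f z - deriv f b * z - (f b - deriv f b * b)
        = (f z - f b) - deriv f b * (z - b) := by ring
    simp only [e] at h
    have h2 : ‖deriv f b * (z - b)‖ ≤ ‖f z - f b‖ + ‖f z - f b - deriv f b * (z - b)‖ := by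
      have := norm_sub_le (f z - f b) (f z - f b - deriv f b * (z - b))
      simpa using this
    rw [norm_mul] at h2
    linarith
  have key := DiffContOnCl.ball_subset_image_closedBall (f := f) (z₀ := b) (r := t / 6)
    (ε := m * t / 12) (DifferentiableOn.diffContOnCl (by
      rw [closure_ball _ (by positivity)]; exact hf.mono hsub)) (by positivity)
    (fun z hz => by
      have := hlow z (sphere_subset_closedBall hz)
      rw [mem_sphere, dist_eq_norm] at hz
      rw [hz] at this
      linarith)
    (by
      have hev : ∀ᶠ z in nhdsWithin b {b}ᶜ, f z ≠ f b :=
        (hfd b (mem_ball_self ht)).eventually_ne hb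
      exact (hev.frequently).filter_mono nhdsWithin_le_nhds)
  have e : m * t / 24 = m * t / 12 / 2 := by ring
  rw [e]
  exact key.trans (Set.image_mono hsub)

/-- A form of Bloch's theorem. -/
theorem norm_deriv_mul_le_of_forall_not_ball_subset {f : ℂ → ℂ} {a : ℂ} {R D : ℝ} (hR : 0 < R)
    (hf : DifferentiableOn ℂ f (ball a R)) (hD : ∀ w, ¬ ball w D ⊆ f '' ball a R) :
    ‖deriv f a‖ * R ≤ 96 * D := by
  have hD0 : 0 < D := by
    by_contra h
    exact hD 0 (by simp [ball_eq_empty.2 (not_lt.1 h)])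
  have hsub : closedBall a (R / 2) ⊆ ball a R := closedBall_subset_ball (by linarith)
  obtain ⟨b, hb, hmax⟩ := (isCompact_closedBall a (R / 2)).exists_isMaxOn
    (f := fun z => ‖deriv f z‖ * (R / 2 - dist z a)) ⟨a, mem_closedBall_self (by positivity)⟩
    ((((hf.deriv isOpen_ball).continuousOn.mono hsub).norm).mul (by fun_prop))
  have ha : ‖deriv f a‖ * (R / 2) ≤ ‖deriv f b‖ * (R / 2 - dist b a) := by
    simpa using hmax (mem_closedBall_self (x := a) (by positivity : 0 ≤ R / 2))
  suffices ‖deriv f b‖ * (R / 2 - dist b a) ≤ 48 * D by linarith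
  by_contra! hlt
  have hprod : 0 < ‖deriv f b‖ * (R / 2 - dist b a) := by linarith
  have hfb : 0 < ‖deriv f b‖ := (norm_nonneg _).lt_of_ne' (left_ne_zero_of_mul hprod.ne')
  have ht : 0 < (R / 2 - dist b a) / 2 := half_pos (pos_of_mul_pos_right hprod hfb.le)
  set t := (R / 2 - dist b a) / 2 with ht_def
  have hbt : ball b t ⊆ closedBall a (R / 2) := fun z hz => by
    rw [mem_ball] at hz
    rw [mem_closedBall]
    linarith [dist_triangle z b a]
  have himg := ball_subset_image_of_norm_deriv_le ht (hf.mono (hbt.trans hsub))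
    (norm_pos_iff.1 hfb) (fun z hz => by
      have h1 : ‖deriv f z‖ * (R / 2 - dist z a) ≤ ‖deriv f b‖ * (R / 2 - dist b a) :=
        hmax (hbt hz)
      rw [mem_ball] at hz
      have h2 : ‖deriv f z‖ * t ≤ ‖deriv f z‖ * (R / 2 - dist z a) := by
        gcongr
        linarith [dist_triangle z b a]
      refine le_of_mul_le_mul_right (h2.trans (h1.trans_eq ?_)) ht
      rw [ht_def]; ring)
  refine hD (f b) ((ball_subset_ball ?_).trans (himg.trans (Set.image_mono (hbt.trans hsub))))
  have : R / 2 - dist b a = 2 * t := by rw [ht_def]; ring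
  rw [this] at hlt
  linarith

theorem exists_int_cosh_eq_of_nonneg {x : ℝ} (hx : 0 ≤ x) :
    ∃ y : ℝ, |y - x| ≤ 3 ∧ ∃ n : ℤ, Real.cosh y = 2 * n + 1 := by
  have h1 : 1 ≤ Real.cosh x := Real.one_le_cosh x
  have h3 : 3 ≤ Real.cosh 3 := by
    rw [Real.cosh_eq]
    have := Real.quadratic_le_exp_of_nonneg (x := 3) (by norm_num)
    have := Real.exp_pos (-3)
    linarith
  have h2 : Real.cosh x + 2 ≤ Real.cosh (x + 3) := by
    rw [Real.cosh_add]
    have := mul_nonneg (Real.sinh_nonneg_iff.2 hx) (Real.sinh_nonneg_iff.2 (zero_le_three (α := ℝ)))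
    nlinarith
  set n : ℤ := ⌈(Real.cosh x - 1) / 2⌉ with hn
  have hn1 := Int.le_ceil ((Real.cosh x - 1) / 2)
  have hn2 := Int.ceil_lt_add_one ((Real.cosh x - 1) / 2)
  rw [← hn] at hn1 hn2
  obtain ⟨y, hy, he⟩ := intermediate_value_Icc (by linarith : x ≤ x + 3)
    Real.continuous_cosh.continuousOn (show (2 * n + 1 : ℝ) ∈ _ from ⟨by linarith, by linarith⟩)
  exact ⟨y, abs_le.2 ⟨by linarith [hy.1], by linarith [hy.2]⟩, n, he⟩

theorem exists_int_cosh_eq (x : ℝ) :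
    ∃ y : ℝ, |y - x| ≤ 3 ∧ ∃ n : ℤ, Real.cosh y = 2 * n + 1 := by
  rcases le_total 0 x with hx | hx
  · exact exists_int_cosh_eq_of_nonneg hx
  · obtain ⟨y, hy, n, hn⟩ := exists_int_cosh_eq_of_nonneg (neg_nonneg.2 hx)
    refine ⟨-y, ?_, n, by rw [Real.cosh_neg, hn]⟩
    rw [← abs_neg]
    convert hy using 2
    ring

/-- Points where `cosh` is an odd integer meet every disk of radius `5`. -/
theorem exists_mem_ball_cosh_eq (w : ℂ) :
    ∃ p ∈ ball w 5, ∃ n : ℤ, cosh p = 2 * n + 1 := by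
  obtain ⟨y, hy, n, hn⟩ := exists_int_cosh_eq w.re
  set m : ℤ := round (w.im / Real.pi) with hm
  have hpi := Real.pi_pos
  have him : |m * Real.pi - w.im| ≤ Real.pi / 2 := by
    have h := abs_sub_round (w.im / Real.pi)
    rw [← hm] at h
    have e : m * Real.pi - w.im = -((w.im / Real.pi - m) * Real.pi) := by field_simp; ring
    rw [e, abs_neg, abs_mul, abs_of_pos hpi]
    nlinarith
  refine ⟨y + (m * Real.pi : ℝ) * I, ?_, ?_⟩
  · rw [mem_ball, dist_eq_norm]
    refine (norm_le_abs_re_add_abs_im _).trans_lt ?_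
    simp only [sub_re, add_re, ofReal_re, mul_re, I_re, I_im, sub_im, add_im, mul_im, ofReal_im]
    simp only [mul_zero, mul_one, sub_zero, zero_add, add_zero]
    have := Real.pi_lt_d2
    linarith
  · have hc : cosh (y : ℂ) = 2 * n + 1 := by
      rw [← ofReal_cosh, hn]; push_cast; rfl
    have hs : sin ((m * Real.pi : ℝ) : ℂ) = 0 := by
      rw [← ofReal_sin, Real.sin_int_mul_pi]; rfl
    have hcos : cos ((m * Real.pi : ℝ) : ℂ) = 1 ∨ cos ((m * Real.pi : ℝ) : ℂ) = -1 := by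
      have h := sin_sq_add_cos_sq ((m * Real.pi : ℝ) : ℂ)
      rw [hs] at h
      simpa using h
    rw [cosh_add, cosh_mul_I, sinh_mul_I, hs, hc]
    rcases hcos with h | h <;> rw [h]
    · exact ⟨n, by ring⟩
    · exact ⟨-n - 1, by push_cast; ring⟩

theorem norm_log_le_abs_log_norm_add_pi (z : ℂ) : ‖log z‖ ≤ |Real.log ‖z‖| + Real.pi := by
  refine (norm_le_abs_re_add_abs_im _).trans ?_
  rw [log_re, log_im]
  gcongr
  exact abs_arg_le_pi z

/-- The derivative bound underlying Schottky's theorem. -/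
theorem norm_deriv_mul_le_of_cosh_ne {k : ℂ → ℂ} {a : ℂ} {R : ℝ} (hR : 0 < R)
    (hk : DifferentiableOn ℂ k (ball a R))
    (hne : ∀ z ∈ ball a R, ∀ n : ℤ, cosh (k z) ≠ 2 * n + 1) :
    ‖deriv k a‖ * R ≤ 480 := by
  refine (norm_deriv_mul_le_of_forall_not_ball_subset (D := 5) hR hk fun w hw => ?_).trans_eq
    (by norm_num)
  obtain ⟨p, hp, n, hn⟩ := exists_mem_ball_cosh_eq w
  obtain ⟨z, hz, rfl⟩ := hw hp
  exact hne z hz n hn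

theorem exists_cosh_eq {r : ℝ} (hr : 0 < r) {P : ℂ → ℂ} (hP : DifferentiableOn ℂ P (ball 0 r))
    (h1 : ∀ z ∈ ball 0 r, P z ^ 2 ≠ 1) (hP0 : ‖P 0‖ ≤ 2) :
    ∃ k : ℂ → ℂ, DifferentiableOn ℂ k (ball 0 r) ∧ ‖k 0‖ ≤ 9 ∧
      ∀ z ∈ ball 0 r, cosh (k z) = P z := by
  have h0 : (0 : ℂ) ∈ ball 0 r := mem_ball_self hr
  obtain ⟨l, hl, -, hle⟩ := exists_differentiableOn_exp_eq (f := fun z => P z ^ 2 - 1)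
    ((hP.pow 2).sub_const 1) (fun z hz => sub_ne_zero.2 (h1 z hz)) h0
  set S : ℂ → ℂ := fun z => exp (l z / 2) with hS_def
  have hS : DifferentiableOn ℂ S (ball 0 r) := (hl.div_const 2).cexp
  have hS2 : ∀ z ∈ ball 0 r, S z ^ 2 = P z ^ 2 - 1 := fun z hz => by
    rw [← hle z hz, hS_def, ← exp_nat_mul]
    congr 1
    push_cast
    ring
  have hinv : ∀ z ∈ ball 0 r, (P z + S z) * (P z - S z) = 1 := fun z hz => by
    linear_combination -hS2 z hz
  obtain ⟨k, hk, hk0, hke⟩ := exists_differentiableOn_exp_eq (f := fun z => P z + S z)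
    (hP.add hS) (fun z hz => left_ne_zero_of_mul_eq_one (hinv z hz)) h0
  refine ⟨k, hk, ?_, fun z hz => ?_⟩
  · have hS0 : ‖S 0‖ ≤ 3 := by
      have h := congrArg norm (hS2 0 h0)
      rw [norm_pow] at h
      have h2 := norm_sub_le (P 0 ^ 2) 1
      rw [norm_pow, norm_one] at h2
      nlinarith [norm_nonneg (S 0), norm_nonneg (P 0)]
    have hadd : ‖P 0 + S 0‖ ≤ 5 := (norm_add_le _ _).trans (by linarith)
    have hsub : ‖P 0 - S 0‖ ≤ 5 := (norm_sub_le _ _).trans (by linarith)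
    have hprod : ‖P 0 + S 0‖ * ‖P 0 - S 0‖ = 1 := by
      rw [← norm_mul, hinv 0 h0, norm_one]
    have hpos : 0 < ‖P 0 + S 0‖ :=
      (norm_nonneg _).lt_of_ne' (left_ne_zero_of_mul_eq_one hprod)
    have hlog : |Real.log ‖P 0 + S 0‖| ≤ 5 := by
      refine abs_le.2 ⟨?_, (Real.log_le_self hpos.le).trans hadd⟩
      have h : Real.log ‖P 0 + S 0‖ = -Real.log ‖P 0 - S 0‖ := by
        rw [← Real.log_inv, eq_inv_of_mul_eq_one_left hprod]
      rw [h]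
      exact neg_le_neg ((Real.log_le_self (norm_nonneg _)).trans hsub)
    rw [hk0]
    linarith [norm_log_le_abs_log_norm_add_pi (P 0 + S 0), Real.pi_lt_four]
  · rw [cosh, exp_neg, hke z hz, inv_eq_of_mul_eq_one_right (hinv z hz)]
    ring

/-- A form of Schottky's theorem. -/
theorem exists_forall_norm_lt_of_omits_of_le_half {s r : ℝ} (hs : 0 < s) (hsr : s < r) :
    ∃ K > 0, ∀ f : ℂ → ℂ, DifferentiableOn ℂ f (ball 0 r) → (∀ z ∈ ball 0 r, f z ≠ 0) →
      (∀ z ∈ ball 0 r, f z ≠ 1) → ‖f 0‖ ≤ 1 / 2 → ∀ z ∈ closedBall 0 s, ‖f z‖ < K := by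
  have hr : 0 < r := hs.trans hsr
  have hrs : 0 < r - s := sub_pos.2 hsr
  refine ⟨Real.exp (Real.pi * (Real.exp (9 + 480 / (r - s) * s) + 1)) + 2, by positivity,
    fun f hf hf0 hf1 hfz z hz => ?_⟩
  have h0 : (0 : ℂ) ∈ ball 0 r := mem_ball_self hr
  have hsub : closedBall (0 : ℂ) s ⊆ ball 0 r := closedBall_subset_ball hsr
  obtain ⟨F, hF, hF0, hFe⟩ := exists_differentiableOn_exp_eq (f := fun z => 1 - f z)
    (hf.const_sub 1) (fun z hz => sub_ne_zero.2 (hf1 z hz).symm) h0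
  have hPeq : ∀ z, F z = Real.pi * I * ((F z / (Real.pi * I) - 1) + 1) := fun z => by
    field_simp [I_ne_zero]
    ring
  set P : ℂ → ℂ := fun z => F z / (Real.pi * I) - 1 with hP_def
  have hP : DifferentiableOn ℂ P (ball 0 r) := (hF.div_const _).sub_const 1
  have hPne : ∀ z ∈ ball 0 r, ∀ n : ℤ, P z ≠ 2 * n + 1 := fun z hz n hn => by
    have h : F z = (n + 1 : ℤ) * (2 * Real.pi * I) := by
      have e := hPeq z
      change F z = Real.pi * I * (P z + 1) at e
      rw [e, hn]; push_cast; ring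
    have h2 := hFe z hz
    rw [h, exp_int_mul_two_pi_mul_I] at h2
    exact hf0 z hz (by linear_combination h2)
  have hP0 : ‖P 0‖ ≤ 2 := by
    have h : ‖F 0‖ ≤ 1 := by
      rw [hF0, sub_eq_add_neg]
      have := norm_log_one_add_half_le_self (z := -f 0) (by simpa using hfz)
      rw [norm_neg] at this
      linarith
    have h2 : ‖F 0 / (Real.pi * I)‖ ≤ 1 := by
      rw [norm_div, norm_mul, norm_I, mul_one, norm_real, Real.norm_of_nonneg Real.pi_pos.le]
      exact div_le_one_of_le₀ (by linarith [Real.pi_gt_three]) Real.pi_pos.le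
    refine (norm_sub_le _ _).trans ?_
    rw [norm_one]
    linarith
  obtain ⟨k, hk, hk0, hkc⟩ := exists_cosh_eq hr hP (fun z hz h => by
    rcases (by simpa using h : P z = 1 ∨ P z = -1) with h | h
    · exact hPne z hz 0 (by simpa using h)
    · exact hPne z hz (-1) (by rw [h]; push_cast; ring)) hP0
  have hder : ∀ x ∈ closedBall (0 : ℂ) s, ‖deriv k x‖ ≤ 480 / (r - s) := fun x hx => by
    have hb : ball x (r - s) ⊆ ball 0 r := ball_subset_ball' (by
      rw [mem_closedBall] at hx; linarith)
    rw [le_div_iff₀ hrs]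
    exact norm_deriv_mul_le_of_cosh_ne hrs (hk.mono hb) fun y hy n => by
      rw [hkc y (hb hy)]; exact hPne y (hb hy) n
  have hkz : ‖k z‖ ≤ 9 + 480 / (r - s) * s := by
    have h := (convex_closedBall (0 : ℂ) s).norm_image_sub_le_of_norm_deriv_le
      (fun x hx => hk.differentiableAt (isOpen_ball.mem_nhds (hsub hx))) hder
      (mem_closedBall_self hs.le) hz
    have h2 : 480 / (r - s) * ‖z - 0‖ ≤ 480 / (r - s) * s := by
      gcongr
      simpa using hz
    have := norm_sub_norm_le (k z) (k 0)
    linarith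
  have hcosh : ‖P z‖ ≤ Real.exp (9 + 480 / (r - s) * s) := by
    rw [← hkc z (hsub hz), cosh, norm_div, norm_ofNat, div_le_iff₀ two_pos]
    have e1 := (norm_exp_le_exp_norm (k z)).trans (Real.exp_le_exp.2 hkz)
    have e2 := (norm_exp_le_exp_norm (-k z)).trans 
      (Real.exp_le_exp.2 ((norm_neg (k z)).trans_le hkz))
    linarith [norm_add_le (exp (k z)) (exp (-k z))]
  have hu : ‖1 - f z‖ ≤ Real.exp (Real.pi * (Real.exp (9 + 480 / (r - s) * s) + 1)) := by
    rw [← hFe z (hsub hz)]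
    refine (norm_exp_le_exp_norm _).trans (Real.exp_le_exp.2 ?_)
    have e : ‖F z‖ = Real.pi * ‖P z + 1‖ := by
      conv_lhs => rw [hPeq z]
      rw [norm_mul, norm_mul, norm_I, mul_one, norm_real, Real.norm_of_nonneg Real.pi_pos.le]
    rw [e]
    have := norm_add_le (P z) 1
    rw [norm_one] at this
    have := Real.pi_pos
    gcongr
    linarith
  have h := norm_sub_norm_le (f z) 1
  rw [norm_sub_rev, norm_one] at h
  linarith

theorem norm_le_mul_norm_zero_of_re_nonpos {r s : ℝ} (hsr : s < r) {g : ℂ → ℂ}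
    (hg : DifferentiableOn ℂ g (ball 0 r)) (hre : ∀ z ∈ ball 0 r, (g z).re ≤ 0) {z : ℂ}
    (hz : z ∈ closedBall 0 s) : ‖g z‖ ≤ (r + s) / (r - s) * ‖g 0‖ := by
  rw [mem_closedBall_zero_iff] at hz
  have hzr : ‖z‖ < r := hz.trans_lt hsr
  have hr : 0 < r := (norm_nonneg z).trans_lt hzr
  have hd : 0 < r - ‖z‖ := sub_pos.2 hzr
  have hd' : 0 < r - s := sub_pos.2 hsr
  have h1 : ∀ M > 0, ‖g z‖ ≤ 2 * ‖z‖ / (r - ‖z‖) * M + ‖g 0‖ * (r + ‖z‖) / (r - ‖z‖) :=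
    fun M hM => by
      have := borelCaratheodory hM hg (fun x hx => (hre x hx).trans hM.le) hr
        (mem_ball_zero_iff.2 hzr)
      convert this using 2
      ring
  have h2 : ‖g z‖ ≤ ‖g 0‖ * (r + ‖z‖) / (r - ‖z‖) := by
    refine ge_of_tendsto (f := fun M : ℝ => 2 * ‖z‖ / (r - ‖z‖) * M +
      ‖g 0‖ * (r + ‖z‖) / (r - ‖z‖)) (x := nhdsWithin 0 (Set.Ioi 0)) ?_
      (eventually_nhdsWithin_of_forall h1)
    refine Filter.Tendsto.mono_left ?_ nhdsWithin_le_nhds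
    exact Continuous.tendsto' (by fun_prop) _ _ (by simp)
  refine h2.trans ?_
  have hs : 0 ≤ s := (norm_nonneg z).trans hz
  rw [div_mul_eq_mul_div, mul_comm]
  gcongr

/-- Harnack-type inequalities for `log (K / ‖f‖)` with `f` bounded by `K` and without zeros. -/
theorem log_div_norm_le {r s K : ℝ} (hs : 0 ≤ s) (hsr : s < r) (hK : 0 < K) {f : ℂ → ℂ}
    (hf : DifferentiableOn ℂ f (ball 0 r)) (hf0 : ∀ z ∈ ball 0 r, f z ≠ 0)
    (hfK : ∀ z ∈ ball 0 r, ‖f z‖ < K) {z : ℂ} (hz : z ∈ closedBall 0 s) :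
    Real.log (K / ‖f z‖) ≤ (r + s) / (r - s) * (Real.log (K / ‖f 0‖) + Real.pi) ∧
    Real.log (K / ‖f 0‖) ≤ (r + s) / (r - s) * (Real.log (K / ‖f z‖) + Real.pi) := by
  have hr : 0 < r := hs.trans_lt hsr
  have h0 : (0 : ℂ) ∈ ball 0 r := mem_ball_self hr
  have hzr : z ∈ ball 0 r := closedBall_subset_ball hsr hz
  have hKc : (K : ℂ) ≠ 0 := ofReal_ne_zero.2 hK.ne'
  have hC : 0 ≤ (r + s) / (r - s) := div_nonneg (by linarith) (by linarith)
  have hlognorm : ∀ x ∈ ball 0 r, Real.log ‖f x / K‖ = -Real.log (K / ‖f x‖) := fun x _ => by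
    rw [← Real.log_inv, inv_div, norm_div, norm_real, Real.norm_of_nonneg hK.le]
  have hlogpos : ∀ x ∈ ball 0 r, 0 < Real.log (K / ‖f x‖) := fun x hx =>
    Real.log_pos ((one_lt_div (norm_pos_iff.2 (hf0 x hx))).2 (hfK x hx))
  have hbranch : ∀ w ∈ ball (0 : ℂ) r, ∃ g : ℂ → ℂ, DifferentiableOn ℂ g (ball 0 r) ∧
      ‖g w‖ ≤ Real.log (K / ‖f w‖) + Real.pi ∧
      ∀ x ∈ ball 0 r, (g x).re = -Real.log (K / ‖f x‖) := fun w hw => by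
    obtain ⟨g, hg, hgw, hge⟩ := exists_differentiableOn_exp_eq (f := fun x => f x / K)
      (hf.div_const _) (fun x hx => div_ne_zero (hf0 x hx) hKc) hw
    refine ⟨g, hg, ?_, fun x hx => ?_⟩
    · have h := norm_log_le_abs_log_norm_add_pi (f w / K)
      rwa [hlognorm w hw, abs_neg, abs_of_pos (hlogpos w hw), ← hgw] at h
    · rw [← hlognorm x hx, ← hge x hx, norm_exp, Real.log_exp]
  have hle : ∀ (g : ℂ → ℂ) x, (g x).re = -Real.log (K / ‖f x‖) →
      Real.log (K / ‖f x‖) ≤ ‖g x‖ := fun g x h => by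
    have := abs_re_le_norm (g x)
    rw [h, abs_neg] at this
    exact (le_abs_self _).trans this
  constructor
  · obtain ⟨g, hg, hg0, hre⟩ := hbranch 0 h0
    refine (hle g z (hre z hzr)).trans
      ((norm_le_mul_norm_zero_of_re_nonpos hsr hg (fun x hx => ?_) hz).trans (by gcongr))
    rw [hre x hx]
    exact neg_nonpos.2 (hlogpos x hx).le
  · obtain ⟨g, hg, hgz, hre⟩ := hbranch z hzr
    have hneg : ∀ x ∈ ball 0 r, (g x).re < 0 := fun x hx => by
      rw [hre x hx]; exact neg_lt_zero.2 (hlogpos x hx)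
    have hgne : ∀ x ∈ ball 0 r, g x ≠ 0 := fun x hx h => by simpa [h] using hneg x hx
    have h := norm_le_mul_norm_zero_of_re_nonpos hsr (g := fun x => (g x)⁻¹) (hg.inv hgne)
      (fun x hx => by
        rw [inv_re]
        exact div_nonpos_of_nonpos_of_nonneg (hneg x hx).le (normSq_nonneg _)) hz
    have p0 := norm_pos_iff.2 (hgne 0 h0)
    have pz := norm_pos_iff.2 (hgne z hzr)
    rw [norm_inv, norm_inv, ← div_eq_mul_inv, inv_le_iff_one_le_mul₀ pz, div_mul_eq_mul_div,
      one_le_div p0] at h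
    exact (hle g 0 (hre 0 h0)).trans (h.trans (by gcongr))

theorem exists_forall_norm_lt_of_omits_zero_one {s r ε : ℝ} (hs : 0 < s) (hsr : s < r)
    (hε : 0 < ε) :
    ∃ δ > 0, ∀ f : ℂ → ℂ, DifferentiableOn ℂ f (ball 0 r) → (∀ z ∈ ball 0 r, f z ≠ 0) →
      (∀ z ∈ ball 0 r, f z ≠ 1) → ‖f 0‖ < δ → ∀ z ∈ closedBall 0 s, ‖f z‖ < ε := by
  obtain ⟨t, hst, htr⟩ := exists_between hsr
  obtain ⟨K, hK, hKf⟩ := exists_forall_norm_lt_of_omits_of_le_half (hs.trans hst) htr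
  set T := (t + s) / (t - s) * (Real.log (K / ε) + Real.pi) with hT
  have hC : 0 ≤ (t + s) / (t - s) := div_nonneg (by linarith) (by linarith)
  refine ⟨min (1 / 2) (K / Real.exp T), by positivity, fun f hf hf0 hf1 hfd z hz => ?_⟩
  by_contra! hge
  have hsub : ball (0 : ℂ) t ⊆ ball 0 r := ball_subset_ball htr.le
  have h0 : (0 : ℂ) ∈ ball 0 r := mem_ball_self (by linarith)
  have hb := (log_div_norm_le hs.le hst hK (hf.mono hsub) (fun x hx => hf0 x (hsub hx))
    (fun x hx => hKf f hf hf0 hf1 (hfd.le.trans (min_le_left _ _)) x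
      (ball_subset_closedBall hx)) hz).2
  have p0 := norm_pos_iff.2 (hf0 0 h0)
  have hlt : T < Real.log (K / ‖f 0‖) := by
    rw [Real.lt_log_iff_exp_lt (by positivity), lt_div_comm₀ (Real.exp_pos _) p0]
    exact hfd.trans_le (min_le_right _ _)
  have hle : Real.log (K / ‖f z‖) ≤ Real.log (K / ε) :=
    Real.log_le_log (div_pos hK (hε.trans_le hge)) (by gcongr)
  refine absurd (hb.trans ?_) hlt.not_ge
  rw [hT]
  gcongr

theorem exists_forall_le_norm_of_ne_zero {s r K η : ℝ} (hs : 0 ≤ s) (hsr : s < r) (hK : 0 < K)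
    (hη : 0 < η) :
    ∃ κ > 0, ∀ f : ℂ → ℂ, DifferentiableOn ℂ f (ball 0 r) → (∀ z ∈ ball 0 r, f z ≠ 0) →
      (∀ z ∈ ball 0 r, ‖f z‖ < K) → η ≤ ‖f 0‖ → ∀ z ∈ closedBall 0 s, κ ≤ ‖f z‖ := by
  set T := (r + s) / (r - s) * (Real.log (K / η) + Real.pi) with hT
  have hC : 0 ≤ (r + s) / (r - s) := div_nonneg (by linarith) (by linarith)
  refine ⟨K / Real.exp T, by positivity, fun f hf hf0 hfK hf1 z hz => ?_⟩
  have hb := (log_div_norm_le hs hsr hK hf hf0 hfK hz).1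
  have pz := norm_pos_iff.2 (hf0 z (closedBall_subset_ball hsr hz))
  have hle : Real.log (K / ‖f 0‖) ≤ Real.log (K / η) :=
    Real.log_le_log (div_pos hK (hη.trans_le hf1)) (by gcongr)
  have hTz : Real.log (K / ‖f z‖) ≤ T := hb.trans (by rw [hT]; gcongr)
  rw [Real.log_le_iff_le_exp (by positivity)] at hTz
  rwa [div_le_comm₀ (Real.exp_pos _) pz]

open Filter Topology

namespace IsHolomorphicMotion

variable {r : ℝ} {E : Set ℂ} {h : ℂ → ℂ → ℂ}

/-- The difference ratio of three points in a holomorphic motion omits `0` and `1`, so it stays small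
on compact subsets of the disk if it is small at the origin. -/
theorem exists_pos_forall_norm_sub_le (hm : IsHolomorphicMotion r E h) {s ε : ℝ} (hs : 0 < s)
    (hsr : s < r) (hε : 0 < ε) :
    ∃ δ > 0, ∀ b ∈ E, ∀ x ∈ E, ∀ y ∈ E, y ≠ b → x ≠ b → ‖x - y‖ < δ * ‖b - y‖ →
      ∀ c ∈ closedBall 0 s, ‖h c x - h c y‖ ≤ ε * ‖h c b - h c y‖ := by
  obtain ⟨hm0, hmi, hmd⟩ := hm
  obtain ⟨δ, hδ, H⟩ := exists_forall_norm_lt_of_omits_zero_one hs hsr hε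
  refine ⟨δ, hδ, fun b hb x hx y hy hyb hxb hlt c hc => ?_⟩
  have hcr : c ∈ ball 0 r := closedBall_subset_ball hsr hc
  have hne : ∀ d ∈ ball 0 r, ∀ u ∈ E, ∀ v ∈ E, u ≠ v → h d u - h d v ≠ 0 :=
    fun d hd u hu v hv huv e => huv (hmi d hd hu hv (sub_eq_zero.1 e))
  rcases eq_or_ne x y with rfl | hxy
  · simp only [sub_self, norm_zero]
    positivity
  have hb0 : ∀ d ∈ ball 0 r, h d b - h d y ≠ 0 := fun d hd => hne d hd b hb y hy hyb.symm
  have key := H (fun d => (h d x - h d y) / (h d b - h d y))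
    (((hmd x hx).sub (hmd y hy)).div ((hmd b hb).sub (hmd y hy)) hb0)
    (fun d hd => div_ne_zero (hne d hd x hx y hy hxy) (hb0 d hd))
    (fun d hd e => hne d hd x hx b hb hxb (by
      linear_combination (div_eq_one_iff_eq (hb0 d hd)).1 e))
    (by
      rw [hm0 x hx, hm0 y hy, hm0 b hb, norm_div,
        div_lt_iff₀ (norm_pos_iff.2 (sub_ne_zero.2 hyb.symm))]
      exact hlt) c hc
  rw [norm_div, div_lt_iff₀ (norm_pos_iff.2 (hb0 c hcr))] at key
  exact key.le

theorem uniformCauchySeqOn (hm : IsHolomorphicMotion r E h) (hE : E.Nontrivial) {s : ℝ}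
    (hs : 0 < s) (hsr : s < r) (w : ℂ) (hw : w ∈ closure E) :
    UniformCauchySeqOn (fun x c => h c x) (𝓝[E] w) (closedBall 0 s) := by
  obtain ⟨b, hb, hbw⟩ := hE.exists_ne w
  have hclose : ∀ η > 0, ∀ᶠ p : ℂ × ℂ in 𝓝[E] w ×ˢ 𝓝[E] w, ∀ c ∈ closedBall 0 s,
      ‖h c p.1 - h c p.2‖ ≤ η * ‖h c b - h c p.2‖ := fun η hη => by
    obtain ⟨δ, hδ, H⟩ := hm.exists_pos_forall_norm_sub_le hs hsr hη
    have h1 : Tendsto Prod.fst (𝓝[E] w ×ˢ 𝓝[E] w) (𝓝 w) :=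
      tendsto_fst.mono_right nhdsWithin_le_nhds
    have h2 : Tendsto Prod.snd (𝓝[E] w ×ˢ 𝓝[E] w) (𝓝 w) :=
      tendsto_snd.mono_right nhdsWithin_le_nhds
    have hlt : ∀ᶠ p : ℂ × ℂ in 𝓝[E] w ×ˢ 𝓝[E] w, ‖p.1 - p.2‖ < δ * ‖b - p.2‖ := by
      refine (h1.sub h2).norm.eventually_lt ((h2.const_sub b).norm.const_mul δ) ?_
      rw [sub_self, norm_zero]
      have := norm_pos_iff.2 (sub_ne_zero.2 hbw)
      positivity
    filter_upwards [hlt, h1.eventually_ne hbw.symm, h2.eventually_ne hbw.symm,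
      tendsto_fst.eventually (eventually_mem_nhdsWithin (s := E) (a := w)),
      tendsto_snd.eventually (eventually_mem_nhdsWithin (s := E) (a := w))]
      with p hp hp1 hp2 hpE1 hpE2
    exact H b hb p.1 hpE1 p.2 hpE2 hp2 hp1 hp
  have hbot : (𝓝[E] w).NeBot := mem_closure_iff_nhdsWithin_neBot.1 hw
  have hball : closedBall (0 : ℂ) s ⊆ ball 0 r := closedBall_subset_ball hsr
  obtain ⟨y₀, hy₀, hy₀E⟩ := ((hclose (1 / 2) one_half_pos).curry.and
    eventually_mem_nhdsWithin).exists
  obtain ⟨M, hM⟩ := (isCompact_closedBall (0 : ℂ) s).exists_bound_of_continuousOn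
    (((hm.2.2 b hb).sub (hm.2.2 y₀ hy₀E)).continuousOn.mono hball)
  have hM0 : 0 ≤ M := (norm_nonneg _).trans (hM 0 (mem_closedBall_self hs.le))
  have hbd : ∀ᶠ y in 𝓝[E] w, ∀ c ∈ closedBall 0 s, ‖h c b - h c y‖ ≤ 2 * M := by
    filter_upwards [hy₀] with y hy c hc
    have h1 := hy c hc
    have h2 : ‖h c b - h c y₀‖ ≤ M := hM c hc
    have h3 := norm_sub_le_norm_sub_add_norm_sub (h c b) (h c y₀) (h c y)
    linarith
  intro u hu
  obtain ⟨ε, hε, hεu⟩ := Metric.mem_uniformity_dist.1 hu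
  filter_upwards [hclose (ε / (2 * M + 1)) (by positivity), tendsto_snd.eventually hbd]
    with p hp hpb c hc
  refine hεu ?_
  rw [dist_eq_norm]
  calc ‖h c p.1 - h c p.2‖ ≤ ε / (2 * M + 1) * ‖h c b - h c p.2‖ := hp c hc
    _ ≤ ε / (2 * M + 1) * (2 * M) := by
        gcongr
        exact hpb c hc
    _ < ε := by
        rw [div_mul_eq_mul_div, div_lt_iff₀ (by positivity)]
        linarith

theorem exists_tendstoUniformlyOn (hm : IsHolomorphicMotion r E h) (hE : E.Nontrivial) {w : ℂ}
    (hw : w ∈ closure E) :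
    ∃ g : ℂ → ℂ, ∀ s, 0 < s → s < r →
      TendstoUniformlyOn (fun x c => h c x) g (𝓝[E] w) (closedBall 0 s) := by
  have hbot : (𝓝[E] w).NeBot := mem_closure_iff_nhdsWithin_neBot.1 hw
  have hlim : ∀ c ∈ ball (0 : ℂ) r, ∃ l, Tendsto (fun x => h c x) (𝓝[E] w) (𝓝 l) :=
    fun c hc => by
      obtain ⟨s, hcs, hsr⟩ := exists_between (mem_ball_zero_iff.1 hc)
      exact cauchy_map_iff_exists_tendsto.1 ((hm.uniformCauchySeqOn hE
        ((norm_nonneg c).trans_lt hcs) hsr w hw).cauchy_map (mem_closedBall_zero_iff.2 hcs.le))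
  choose! g hg using hlim
  exact ⟨g, fun s hs hsr => (hm.uniformCauchySeqOn hE hs hsr w hw).tendstoUniformlyOn_of_tendsto
    fun c hc => hg c (closedBall_subset_ball hsr hc)⟩

theorem tendsto_of_tendstoUniformlyOn {w : ℂ} {k : ℂ → ℂ}
    (hk : ∀ s, 0 < s → s < r → TendstoUniformlyOn (fun x c => h c x) k (𝓝[E] w) (closedBall 0 s))
    {c : ℂ} (hc : c ∈ ball 0 r) : Tendsto (h c) (𝓝[E] w) (𝓝 (k c)) := by
  obtain ⟨s, hcs, hsr⟩ := exists_between (mem_ball_zero_iff.1 hc)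
  exact (hk s ((norm_nonneg c).trans_lt hcs) hsr).tendsto_at (mem_closedBall_zero_iff.2 hcs.le)

theorem differentiableOn_of_tendstoUniformlyOn (hm : IsHolomorphicMotion r E h) {w : ℂ}
    (hw : w ∈ closure E) {k : ℂ → ℂ}
    (hk : ∀ s, 0 < s → s < r →
      TendstoUniformlyOn (fun x c => h c x) k (𝓝[E] w) (closedBall 0 s)) :
    DifferentiableOn ℂ k (ball 0 r) := by
  have hbot : (𝓝[E] w).NeBot := mem_closure_iff_nhdsWithin_neBot.1 hw
  refine TendstoLocallyUniformlyOn.differentiableOn (φ := 𝓝[E] w) (F := fun x c => h c x) ?_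
    (eventually_mem_nhdsWithin.mono fun x hx => hm.2.2 x hx) isOpen_ball
  rw [tendstoLocallyUniformlyOn_iff_forall_isCompact isOpen_ball]
  intro K hKr hK
  rcases K.eq_empty_or_nonempty with rfl | hne
  · exact tendstoUniformlyOn_empty
  obtain ⟨c, hc, hmax⟩ := hK.exists_isMaxOn hne continuous_norm.continuousOn
  obtain ⟨s, hcs, hsr⟩ := exists_between (mem_ball_zero_iff.1 (hKr hc))
  exact (hk s ((norm_nonneg c).trans_lt hcs) hsr).mono fun x hx =>
    mem_closedBall_zero_iff.2 ((hmax hx).trans hcs.le)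

theorem eventually_forall_norm_lt {w : ℂ} {k : ℂ → ℂ} {s : ℝ}
    (hsr : s < r) (hkd : DifferentiableOn ℂ k (ball 0 r))
    (hk : TendstoUniformlyOn (fun x c => h c x) k (𝓝[E] w) (closedBall 0 s)) :
    ∃ M, ∀ᶠ x in 𝓝[E] w, ∀ c ∈ closedBall 0 s, ‖h c x‖ < M := by
  obtain ⟨M, hM⟩ := (isCompact_closedBall (0 : ℂ) s).exists_bound_of_continuousOn
    (hkd.continuousOn.mono (closedBall_subset_ball hsr))
  refine ⟨M + 1, (Metric.tendstoUniformlyOn_iff.1 hk 1 one_pos).mono fun x hx c hc => ?_⟩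
  have h1 := hx c hc
  rw [dist_comm, dist_eq_norm] at h1
  linarith [hM c hc, norm_sub_norm_le (h c x) (k c)]

theorem ne_of_tendstoUniformlyOn (hm : IsHolomorphicMotion r E h) {z w : ℂ}
    (hz : z ∈ closure E) (hw : w ∈ closure E) (hzw : z ≠ w) {k l : ℂ → ℂ}
    (hk : ∀ s, 0 < s → s < r →
      TendstoUniformlyOn (fun x c => h c x) k (𝓝[E] z) (closedBall 0 s))
    (hl : ∀ s, 0 < s → s < r →
      TendstoUniformlyOn (fun x c => h c x) l (𝓝[E] w) (closedBall 0 s))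
    {c : ℂ} (hc : c ∈ ball 0 r) : k c ≠ l c := by
  have hbz : (𝓝[E] z).NeBot := mem_closure_iff_nhdsWithin_neBot.1 hz
  have hbw : (𝓝[E] w).NeBot := mem_closure_iff_nhdsWithin_neBot.1 hw
  obtain ⟨t, hct, htr⟩ := exists_between (mem_ball_zero_iff.1 hc)
  have ht : 0 < t := (norm_nonneg c).trans_lt hct
  have h0 : (0 : ℂ) ∈ ball 0 r := mem_ball_self (ht.trans htr)
  have hsub : ball (0 : ℂ) t ⊆ ball 0 r := ball_subset_ball htr.le
  obtain ⟨A, hA⟩ := eventually_forall_norm_lt htr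
    (hm.differentiableOn_of_tendstoUniformlyOn hz hk) (hk t ht htr)
  obtain ⟨B, hB⟩ := eventually_forall_norm_lt htr
    (hm.differentiableOn_of_tendstoUniformlyOn hw hl) (hl t ht htr)
  have hη : 0 < ‖z - w‖ := norm_pos_iff.2 (sub_ne_zero.2 hzw)
  obtain ⟨κ, hκ, H⟩ := exists_forall_le_norm_of_ne_zero (norm_nonneg c) hct
    (K := max 1 (A + B)) (by positivity) (half_pos hη)
  have hd : Tendsto (fun p : ℂ × ℂ => p.1 - p.2) (𝓝[E] z ×ˢ 𝓝[E] w) (𝓝 (z - w)) :=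
    (tendsto_fst.mono_right nhdsWithin_le_nhds).sub (tendsto_snd.mono_right nhdsWithin_le_nhds)
  have hlow : ∀ᶠ p : ℂ × ℂ in 𝓝[E] z ×ˢ 𝓝[E] w, κ ≤ ‖h c p.1 - h c p.2‖ := by
    filter_upwards [hd.norm.eventually_const_le (half_lt_self hη),
      hA.prod_inl (𝓝[E] w), hB.prod_inr (𝓝[E] z),
      eventually_mem_nhdsWithin.prod_inl (𝓝[E] w), eventually_mem_nhdsWithin.prod_inr (𝓝[E] z)]
      with p hp hpA hpB hpz hpw
    have hne : p.1 ≠ p.2 := fun e => by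
      rw [e, sub_self, norm_zero] at hp
      linarith
    exact H (fun d => h d p.1 - h d p.2)
      (((hm.2.2 _ hpz).sub (hm.2.2 _ hpw)).mono hsub)
      (fun d hd => sub_ne_zero.2 fun e => hne (hm.2.1 d (hsub hd) hpz hpw e))
      (fun d hd => (norm_sub_le _ _).trans_lt ((add_lt_add (hpA d (ball_subset_closedBall hd))
        (hpB d (ball_subset_closedBall hd))).trans_le (le_max_right _ _)))
      (by rwa [hm.1 _ hpz, hm.1 _ hpw]) c (mem_closedBall_zero_iff.2 le_rfl)
  have hlim : Tendsto (fun p : ℂ × ℂ => h c p.1 - h c p.2) (𝓝[E] z ×ˢ 𝓝[E] w)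
      (𝓝 (k c - l c)) :=
    ((tendsto_of_tendstoUniformlyOn hk hc).comp tendsto_fst).sub
      ((tendsto_of_tendstoUniformlyOn hl hc).comp tendsto_snd)
  have := ge_of_tendsto hlim.norm hlow
  exact sub_ne_zero.1 (norm_pos_iff.1 (hκ.trans_le this))

end IsHolomorphicMotion

/-- λ-Lemma of Mañé–Sad–Sullivan: a holomorphic motion of `E` parametrized by `Δ_r`
extends to a holomorphic motion of the closure of `E` parametrized by the same disk. -/
theorem lambda_lemma
    (r : ℝ) (hr : 0 < r) (E : Set ℂ) (h : ℂ → ℂ → ℂ)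
    (hmot : IsHolomorphicMotion r E h) :
    ∃ H : ℂ → ℂ → ℂ, IsHolomorphicMotion r (closure E) H ∧
      ∀ c ∈ ball (0:ℂ) r, ∀ z ∈ E, H c z = h c z := by
  rcases E.subsingleton_or_nontrivial with hE | hE
  · refine ⟨h, ?_, fun _ _ _ _ => rfl⟩
    rwa [hE.isClosed.closure_eq]
  have hex := fun w (hw : w ∈ closure E) => hmot.exists_tendstoUniformlyOn hE hw
  choose! g hg using hex
  have hlim : ∀ z ∈ closure E, ∀ c ∈ ball (0 : ℂ) r, Tendsto (h c) (𝓝[E] z) (𝓝 (g z c)) :=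
    fun z hz c hc => IsHolomorphicMotion.tendsto_of_tendstoUniformlyOn (hg z hz) hc
  have h0 : (0 : ℂ) ∈ ball 0 r := mem_ball_self hr
  refine ⟨fun c z => g z c, ⟨fun z hz => ?_, fun c hc z hz w hw hzw => ?_, fun z hz =>
    hmot.differentiableOn_of_tendstoUniformlyOn hz (hg z hz)⟩, fun c hc z hz => ?_⟩
  · have hbot : (𝓝[E] z).NeBot := mem_closure_iff_nhdsWithin_neBot.1 hz
    refine tendsto_nhds_unique (hlim z hz 0 h0) ?_
    refine (tendsto_id.mono_left nhdsWithin_le_nhds).congr' ?_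
    exact eventually_mem_nhdsWithin.mono fun x hx => (hmot.1 x hx).symm
  · by_contra hne
    exact hmot.ne_of_tendstoUniformlyOn hz hw hne (hg z hz) (hg w hw) hc hzw
  · exact tendsto_nhds_unique ((hlim z (subset_closure hz) c hc).mono_left (pure_le_nhdsWithin hz))
      (tendsto_pure_nhds _ _)
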